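/- arXiv:1109.2353 — 6 statements merged into one kernel-verified Lean document; each statement's English description precedes it below -/
import Mathlib

section
/- Let K = 𝔽_q be a finite field. The vanishing ideal I(X*) ⊆ S = K[t_1,…,t_s] of the affine algebraic toric set X* is a binomial ideal, i.e., it is generated by polynomials of the form t^a − t^b with a, b ∈ ℕ^s. -/
open MvPolynomial

/-- The affine algebraic toric set parameterized by the monomials
`y^{v_1}, …, y^{v_s}`. -/
def Xstar (K : Type*) [Field K] {s n : ℕ} (v : Fin s → Fin n → ℕ) : Set (Fin s → K) :=
  {p | ∃ x : Fin n → K, (∀ j, x j ≠ 0) ∧ ∀ i, p i = ∏ j, x j ^ v i j}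

/-- The vanishing ideal of `X* ⊆ K^s` in `S = K[t_1,…,t_s]`: all polynomials
vanishing at every point of `X*`. -/
noncomputable def vanishingIdealXstar (K : Type*) [Field K] {s n : ℕ}
    (v : Fin s → Fin n → ℕ) : Ideal (MvPolynomial (Fin s) K) :=
  ⨅ p ∈ Xstar K v, RingHom.ker (eval p)

/-- A binomial of `S = K[t_1,…,t_s]`: a polynomial of the form `t^a - t^b`. -/
def IsBinomial {σ K : Type*} [CommRing K] (f : MvPolynomial σ K) : Prop :=
  ∃ a b : σ →₀ ℕ, f = monomial a (1 : K) - monomial b (1 : K)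

/-- The point of the toric set attached to `x`, as a multiplicative function of `x`. -/
def toricPt {K : Type*} [Field K] {s n : ℕ} (v : Fin s → Fin n → ℕ)
    (x : Fin n → Kˣ) : Fin s → K := fun i => ∏ j, (x j : K) ^ v i j

/-- The character of the torus attached to the exponent `a`. -/
def toricChar {K : Type*} [Field K] {s n : ℕ} (v : Fin s → Fin n → ℕ)
    (a : Fin s →₀ ℕ) : (Fin n → Kˣ) →* K where
  toFun x := ∏ i, toricPt v x i ^ a i
  map_one' := by simp [toricPt]
  map_mul' x y := by
    simp [toricPt, mul_pow, Finset.prod_mul_distrib]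

lemma mem_vanishing_iff {K : Type*} [Field K] {s n : ℕ} (v : Fin s → Fin n → ℕ)
    (f : MvPolynomial (Fin s) K) :
    f ∈ vanishingIdealXstar K v ↔ ∀ x : Fin n → Kˣ, eval (toricPt v x) f = 0 := by
  simp only [vanishingIdealXstar, Ideal.mem_iInf, RingHom.mem_ker]
  constructor
  · intro h x
    exact h _ ⟨fun j => x j, fun j => (x j).ne_zero, fun i => rfl⟩
  · rintro h p ⟨x, hx, hp⟩
    have := h (fun j => Units.mk0 (x j) (hx j))
    have e : p = toricPt v (fun j => Units.mk0 (x j) (hx j)) := by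
      funext i; simp [toricPt, hp]
    rw [e]; exact this

lemma eval_monomial_toric {K : Type*} [Field K] {s n : ℕ} (v : Fin s → Fin n → ℕ)
    (a : Fin s →₀ ℕ) (x : Fin n → Kˣ) :
    eval (toricPt v x) (monomial a (1 : K)) = toricChar v a x := by
  rw [eval_monomial, one_mul, Finsupp.prod_fintype _ _ (by simp)]
  rfl

/-- **Theorem.** Over a finite field `K = 𝔽_q`, the vanishing ideal `I(X*)` of the
affine algebraic toric set `X*` is a binomial ideal: it is generated by
polynomials of the form `t^a - t^b`. -/
theorem vanishingIdeal_Xstar_isBinomialIdeal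
    {K : Type*} [Field K] [Fintype K] {s n : ℕ} (v : Fin s → Fin n → ℕ) :
    ∃ G : Set (MvPolynomial (Fin s) K),
      (∀ g ∈ G, IsBinomial g) ∧ vanishingIdealXstar K v = Ideal.span G := by
  classical
  let G : Set (MvPolynomial (Fin s) K) :=
    {g | ∃ a b : Fin s →₀ ℕ, toricChar (K := K) v a = toricChar v b ∧
      g = monomial a (1 : K) - monomial b (1 : K)}
  refine ⟨G, ?_, le_antisymm ?_ ?_⟩
  · rintro g ⟨a, b, -, rfl⟩
    exact ⟨a, b, rfl⟩
  · intro f hf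
    rw [mem_vanishing_iff] at hf
    let L : MvPolynomial (Fin s) K →ₗ[K] (((Fin n → Kˣ) →* K) →₀ K) :=
      (basisMonomials (Fin s) K).constr K (fun a => Finsupp.single (toricChar v a) 1)
    have hL : ∀ a, L (monomial a 1) = Finsupp.single (toricChar v a) 1 := by
      intro a
      have := (basisMonomials (Fin s) K).constr_basis K
        (fun a => Finsupp.single (toricChar (K := K) v a) (1 : K)) a
      simpa only [coe_basisMonomials] using this
    let E : MvPolynomial (Fin s) K →ₗ[K] ((Fin n → Kˣ) → K) :=
      LinearMap.pi fun x => (aeval (toricPt v x) : MvPolynomial (Fin s) K →ₐ[K] K).toLinearMap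
    have hE : E = (Finsupp.linearCombination K
        (fun φ : (Fin n → Kˣ) →* K => (φ : (Fin n → Kˣ) → K))) ∘ₗ L := by
      refine (basisMonomials (Fin s) K).ext fun a => ?_
      funext x
      have := eval_monomial_toric (K := K) v a x
      simp only [coe_basisMonomials, LinearMap.comp_apply, hL,
        Finsupp.linearCombination_single, one_smul]
      rw [← this]
      simp [E, aeval_eq_eval]
    have hEf : E f = 0 := by
      funext x
      simpa [E, aeval_eq_eval] using hf x
    have hLf : L f = 0 := by
      rw [hE] at hEf
      exact linearIndependent_iff.1 (linearIndependent_monoidHom (Fin n → Kˣ) K) _ hEf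
    let R : (((Fin n → Kˣ) →* K) →₀ K) →ₗ[K] (MvPolynomial (Fin s) K ⧸ Ideal.span G) :=
      Finsupp.linearCombination K fun φ =>
        Ideal.Quotient.mk _ (monomial (Function.invFun (toricChar v) φ) (1 : K))
    have hR : (Ideal.Quotient.mkₐ K (Ideal.span G)).toLinearMap = R ∘ₗ L := by
      refine (basisMonomials (Fin s) K).ext fun a => ?_
      simp only [coe_basisMonomials, LinearMap.comp_apply, hL, R,
        Finsupp.linearCombination_single, one_smul]
      refine Ideal.Quotient.eq.2 (Ideal.subset_span ⟨_, _, ?_, rfl⟩)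
      exact (Function.invFun_eq (f := toricChar (K := K) v) ⟨a, rfl⟩).symm
    have := LinearMap.congr_fun hR f
    rw [LinearMap.comp_apply, hLf, map_zero] at this
    exact Ideal.Quotient.eq_zero_iff_mem.1 this
  · rw [Ideal.span_le]
    rintro g ⟨a, b, hab, rfl⟩
    rw [SetLike.mem_coe, mem_vanishing_iff]
    intro x
    rw [map_sub, eval_monomial_toric, eval_monomial_toric, hab, sub_self]
end

section
/- For every d ≥ 1, the K-linear map φ : K^{X*} → K^{X*} given by φ(w)(P) = w(P)/P_1^d (where P_1 is the first coordinate of P, which is nonzero) restricts to a K-linear isomorphism from the parameterized affine code C_{X*}(d) onto the parameterized projective code C_Y(d). -/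
open MvPolynomial

noncomputable section

/-- The evaluation map `S = K[t_1,…,t_s] → K^{X*}`, `f ↦ (f(P))_{P ∈ X*}`. -/
def evalAff (K : Type*) [Field K] {s n : ℕ} (v : Fin s → Fin n → ℕ) :
    MvPolynomial (Fin s) K →ₗ[K] (Xstar K v → K) :=
  LinearMap.pi fun p => (aeval (p : Fin s → K)).toLinearMap

/-- The parameterized affine code `C_{X*}(d)`: the image under evaluation of the
space `S_{≤ d}` of polynomials of total degree at most `d`. -/
def CAff (K : Type*) [Field K] {s n : ℕ} (v : Fin s → Fin n → ℕ) (d : ℕ) :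
    Submodule K (Xstar K v → K) :=
  Submodule.map (evalAff K v) (restrictTotalDegree (Fin s) K d)

/-- The evaluation map `S[u]_d → K^{X*}`, `F ↦ (F(P,1)/P_1^d)_{P ∈ X*}`, where the
variable `u` is indexed by `none` and `t_i` by `some i`. -/
def evProj (K : Type*) [Field K] {s n : ℕ} (hs : 0 < s) (v : Fin s → Fin n → ℕ)
    (d : ℕ) : MvPolynomial (Option (Fin s)) K →ₗ[K] (Xstar K v → K) where
  toFun F p := eval (fun j => j.elim 1 (p : Fin s → K)) F / ((p : Fin s → K) ⟨0, hs⟩) ^ d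
  map_add' F G := by funext p; simp [add_div]
  map_smul' c F := by funext p; simp [MvPolynomial.smul_eval, mul_div_assoc]

/-- The parameterized projective code `C_Y(d)`: the image under `ev'_d` of the space
`S[u]_d` of homogeneous polynomials of degree `d`. -/
def CProj (K : Type*) [Field K] {s n : ℕ} (hs : 0 < s) (v : Fin s → Fin n → ℕ)
    (d : ℕ) : Submodule K (Xstar K v → K) :=
  Submodule.map (evProj K hs v d) (homogeneousSubmodule (Option (Fin s)) K d)

/-- The `K`-linear map `φ : K^{X*} → K^{X*}`, `φ(w)(P) = w(P)/P_1^d`. -/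
def phiMap (K : Type*) [Field K] {s n : ℕ} (hs : 0 < s) (v : Fin s → Fin n → ℕ)
    (d : ℕ) : (Xstar K v → K) →ₗ[K] (Xstar K v → K) where
  toFun w p := w p / ((p : Fin s → K) ⟨0, hs⟩) ^ d
  map_add' w w' := by funext p; simp [add_div]
  map_smul' c w := by funext p; simp [mul_div_assoc]

/-- **Theorem.** For every `d ≥ 1`, the map `φ(w)(P) = w(P)/P_1^d` restricts to a
`K`-linear isomorphism from the parameterized affine code `C_{X*}(d)` onto the
parameterized projective code `C_Y(d)`: it maps `C_{X*}(d)` onto `C_Y(d)` and is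
injective on `C_{X*}(d)`. -/
theorem phi_restricts_to_iso_CAff_CProj
    {K : Type*} [Field K] [Fintype K] {s n : ℕ} (hs : 0 < s)
    (v : Fin s → Fin n → ℕ) (d : ℕ) (hd : 1 ≤ d) :
    Submodule.map (phiMap K hs v d) (CAff K v d) = CProj K hs v d ∧
      Set.InjOn (phiMap K hs v d) (CAff K v d : Set (Xstar K v → K)) := by
  have hne : ∀ p : Xstar K v, ((p : Fin s → K) ⟨0, hs⟩) ^ d ≠ 0 := by
    rintro ⟨p, x, hx, hp⟩
    apply pow_ne_zero
    change p ⟨0, hs⟩ ≠ 0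
    rw [hp]
    exact Finset.prod_ne_zero_iff.mpr fun j _ => pow_ne_zero _ (hx j)
  refine ⟨?_, ?_⟩
  · apply le_antisymm
    · rintro _ ⟨_, ⟨f, hf, rfl⟩, rfl⟩
      have hf' : f.totalDegree ≤ d := (mem_restrictTotalDegree _ _ _).1 hf
      refine ⟨∑ m ∈ f.support, monomial (Finsupp.optionElim (d - m.degree) m) (coeff m f), ?_, ?_⟩
      · refine Submodule.sum_mem _ fun m hm => ?_
        rw [mem_homogeneousSubmodule]
        apply isHomogeneous_monomial
        have h1 : m.degree ≤ d := by
          refine le_trans ?_ hf'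
          have := le_totalDegree hm
          exact this
        rw [Finsupp.degree_eq_sum] at h1 ⊢
        simp [Fintype.sum_option, Finsupp.degree_eq_sum]
        omega
      · funext p
        change eval (fun j => j.elim 1 (p : Fin s → K)) (_ : MvPolynomial (Option (Fin s)) K) / ((p : Fin s → K) ⟨0, hs⟩) ^ d =
          aeval (p : Fin s → K) f / ((p : Fin s → K) ⟨0, hs⟩) ^ d
        congr 1
        conv_rhs => rw [f.as_sum]
        rw [map_sum, map_sum]
        refine Finset.sum_congr rfl fun m hm => ?_
        rw [eval_monomial, aeval_monomial, Finsupp.prod_fintype _ _ (by simp),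
          Finsupp.prod_fintype _ _ (by simp), Fintype.prod_option]
        simp
    · rintro _ ⟨F, hF, rfl⟩
      have hF' : F.IsHomogeneous d := hF
      refine ⟨_, ⟨∑ m ∈ F.support, monomial m.some (coeff m F), ?_, rfl⟩, ?_⟩
      · refine Submodule.sum_mem _ fun m hm => ?_
        rw [mem_restrictTotalDegree]
        refine (totalDegree_monomial_le _ _).trans ?_
        have h1 : m.degree = d := by
          by_contra h
          exact (mem_support_iff.1 hm) (hF'.coeff_eq_zero h)
        rw [Finsupp.degree_eq_sum, Fintype.sum_option] at h1
        rw [Finsupp.sum_fintype _ _ (by simp)]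
        simp
        omega
      · funext p
        change aeval (p : Fin s → K) (_ : MvPolynomial (Fin s) K) / ((p : Fin s → K) ⟨0, hs⟩) ^ d =
          eval (fun j => j.elim 1 (p : Fin s → K)) F / ((p : Fin s → K) ⟨0, hs⟩) ^ d
        congr 1
        conv_rhs => rw [F.as_sum]
        rw [map_sum, map_sum]
        refine Finset.sum_congr rfl fun m hm => ?_
        rw [eval_monomial, aeval_monomial, Finsupp.prod_fintype _ _ (by simp),
          Finsupp.prod_fintype _ _ (by simp), Fintype.prod_option]
        simp
  · intro w _ w' _ h
    funext p
    have := congrFun h p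
    exact (div_left_inj' (hne p)).1 this


end
end

section
/- For every d ≥ 1, the parameterized affine code C_{X*}(d) and the parameterized projective code C_Y(d) have the same basic parameters: they have the same length |X*|, the same dimension dim_K C_{X*}(d) = dim_K C_Y(d), and the same minimum distance δ_{X*}(d) = δ_Y(d). -/
open MvPolynomial

noncomputable section

/-- The Hamming weight `‖w‖` of a word: the number of its nonzero entries. -/
def wt {α K : Type*} [Zero K] (w : α → K) : ℕ := Set.ncard {a | w a ≠ 0}

/-- The minimum distance of a linear code `C ⊆ K^α`: the minimum weight of a
nonzero codeword. -/
def minDist {α K : Type*} [Field K] (C : Submodule K (α → K)) : ℕ :=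
  sInf {m | ∃ w ∈ C, w ≠ 0 ∧ wt w = m}

lemma Xstar_ne_zero {K : Type*} [Field K] {s n : ℕ} {v : Fin s → Fin n → ℕ}
    (p : Xstar K v) (i : Fin s) : (p : Fin s → K) i ≠ 0 := by
  obtain ⟨x, hx, h⟩ := p.2
  rw [h i]
  exact Finset.prod_ne_zero_iff.mpr fun j _ => pow_ne_zero _ (hx j)

/-- Diagonal scaling of words by `P_1^{-d}`. -/
def scaleEquiv (K : Type*) [Field K] {s n : ℕ} (hs : 0 < s) (v : Fin s → Fin n → ℕ)
    (d : ℕ) : (Xstar K v → K) ≃ₗ[K] (Xstar K v → K) where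
  toFun w p := w p / ((p : Fin s → K) ⟨0, hs⟩) ^ d
  invFun w p := w p * ((p : Fin s → K) ⟨0, hs⟩) ^ d
  map_add' F G := by funext p; simp [add_div]
  map_smul' c F := by funext p; simp [mul_div_assoc]
  left_inv w := by
    funext p
    exact div_mul_cancel₀ _ (pow_ne_zero _ (Xstar_ne_zero p _))
  right_inv w := by
    funext p
    exact mul_div_cancel_right₀ _ (pow_ne_zero _ (Xstar_ne_zero p _))

/-- Homogenization in degree `d`. -/
lemma exists_homog {K : Type*} [Field K] {s : ℕ} (d : ℕ) (f : MvPolynomial (Fin s) K)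
    (hf : f.totalDegree ≤ d) : ∃ F : MvPolynomial (Option (Fin s)) K,
      F.IsHomogeneous d ∧ ∀ p : Fin s → K, eval (fun j => j.elim 1 p) F = eval p f := by
  refine ⟨∑ m ∈ f.support, X none ^ (d - m.degree) * rename some (monomial m (coeff m f)),
    ?_, ?_⟩
  · apply IsHomogeneous.sum
    intro m hm
    have h1 : m.degree ≤ d := (le_totalDegree hm).trans hf
    have h2 := ((isHomogeneous_X K (none : Option (Fin s))).pow (d - m.degree)).mul
      ((isHomogeneous_monomial (coeff m f) (rfl : m.degree = m.degree)).rename_isHomogeneous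
        (f := some))
    have h3 : 1 * (d - m.degree) + m.degree = d := by omega
    rwa [h3] at h2
  · intro p
    conv_rhs => rw [f.as_sum]
    rw [map_sum, map_sum]
    refine Finset.sum_congr rfl fun m _ => ?_
    rw [map_mul, map_pow, eval_X, eval_rename]
    simp [Function.comp_def]

/-- Dehomogenization. -/
lemma exists_dehomog {K : Type*} [Field K] {s : ℕ} (d : ℕ) (F : MvPolynomial (Option (Fin s)) K)
    (hF : F.totalDegree ≤ d) : ∃ f : MvPolynomial (Fin s) K,
      f.totalDegree ≤ d ∧ ∀ p : Fin s → K, eval p f = eval (fun j => j.elim 1 p) F := by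
  refine ⟨∑ m ∈ F.support, C (coeff m F) * ∏ j ∈ m.support, (j.elim 1 X) ^ m j, ?_, ?_⟩
  · apply totalDegree_finsetSum_le
    intro m hm
    have h1 : m.degree ≤ d := (le_totalDegree hm).trans hF
    refine (totalDegree_mul _ _).trans ?_
    rw [totalDegree_C, zero_add]
    refine (totalDegree_finset_prod _ _).trans (le_trans (Finset.sum_le_sum ?_) h1)
    intro j _
    refine (totalDegree_pow _ _).trans ?_
    cases j <;> simp
  · intro p
    conv_rhs => rw [F.as_sum]
    rw [map_sum, map_sum]
    refine Finset.sum_congr rfl fun m _ => ?_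
    rw [eval_monomial, map_mul, eval_C, map_prod, Finsupp.prod]
    congr 1
    refine Finset.prod_congr rfl fun j _ => ?_
    cases j <;> simp

lemma CProj_eq_map {K : Type*} [Field K] {s n : ℕ} (hs : 0 < s)
    (v : Fin s → Fin n → ℕ) (d : ℕ) :
    CProj K hs v d = (CAff K v d).map (scaleEquiv K hs v d).toLinearMap := by
  ext w
  constructor
  · rintro ⟨F, hF, rfl⟩
    obtain ⟨f, hf, h⟩ := exists_dehomog d F (IsHomogeneous.totalDegree_le hF)
    refine ⟨_, ⟨f, (mem_restrictTotalDegree _ _ _).mpr hf, rfl⟩, ?_⟩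
    funext p
    simp [scaleEquiv, evalAff, evProj, aeval_eq_eval, ← h]
  · rintro ⟨_, ⟨f, hf, rfl⟩, rfl⟩
    obtain ⟨F, hF, h⟩ := exists_homog d f ((mem_restrictTotalDegree _ _ _).mp hf)
    refine ⟨F, hF, ?_⟩
    funext p
    simp [scaleEquiv, evalAff, evProj, aeval_eq_eval, h]

lemma wt_scale {K : Type*} [Field K] {s n : ℕ} (hs : 0 < s)
    (v : Fin s → Fin n → ℕ) (d : ℕ) (w : Xstar K v → K) :
    wt (scaleEquiv K hs v d w) = wt w := by
  unfold wt
  congr 1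
  ext p
  simp [scaleEquiv, Xstar_ne_zero p]

/-- **Theorem.** For every `d ≥ 1`, the parameterized affine code `C_{X*}(d)` and the
parameterized projective code `C_Y(d)` have the same basic parameters: the same
length `|X*|` (both being codes in `K^{X*}`), the same dimension, and the same
minimum distance. -/
theorem CAff_CProj_same_parameters
    {K : Type*} [Field K] [Fintype K] {s n : ℕ} (hs : 0 < s)
    (v : Fin s → Fin n → ℕ) (d : ℕ) (hd : 1 ≤ d) :
    Module.finrank K (CAff K v d) = Module.finrank K (CProj K hs v d) ∧
      minDist (CAff K v d) = minDist (CProj K hs v d) := by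
  rw [CProj_eq_map]
  refine ⟨(LinearEquiv.finrank_map_eq (scaleEquiv K hs v d) (CAff K v d)).symm, ?_⟩
  unfold minDist
  congr 1
  ext m
  constructor
  · rintro ⟨w, hw, h0, rfl⟩
    exact ⟨scaleEquiv K hs v d w, ⟨w, hw, rfl⟩,
      fun h => h0 ((scaleEquiv K hs v d).map_eq_zero_iff.mp h), wt_scale hs v d w⟩
  · rintro ⟨_, ⟨w, hw, rfl⟩, h0, rfl⟩
    refine ⟨w, hw, ?_, (wt_scale hs v d w).symm⟩
    rintro rfl
    exact h0 (map_zero _)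

end
end

section
/- For every d ≥ 1, the dimension of the parameterized affine code C_{X*}(d) equals the Hilbert function H_Y(d) of S[u]/I(Y) in degree d; that is, dim_K C_{X*}(d) = dim_K (S[u]_d / (I(Y) ∩ S[u]_d)). -/
open MvPolynomial

noncomputable section

/-- The vanishing ideal `I(Y) ⊆ S[u] = K[t_1,…,t_s,u]` of the projective closure `Y`:
the ideal generated by the homogeneous polynomials `F` with `F(P,1) = 0` for all
`P ∈ X*`.  The variable `u` is indexed by `none` and `t_i` by `some i`. -/
def IY (K : Type*) [Field K] {s n : ℕ} (v : Fin s → Fin n → ℕ) :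
    Ideal (MvPolynomial (Option (Fin s)) K) :=
  Ideal.span {F | (∃ e, F.IsHomogeneous e) ∧
    ∀ p ∈ Xstar K v, eval (fun j => j.elim 1 p) F = 0}

/-- The Hilbert function of `S[u]/I(Y)` in degree `d`:
`H_Y(d) = dim_K (S[u]_d / (I(Y) ∩ S[u]_d))`. -/
def HY (K : Type*) [Field K] {s n : ℕ} (v : Fin s → Fin n → ℕ) (d : ℕ) : ℕ :=
  Module.finrank K
    (↥(homogeneousSubmodule (Option (Fin s)) K d) ⧸
      Submodule.comap (homogeneousSubmodule (Option (Fin s)) K d).subtype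
        (Submodule.restrictScalars K (IY K v) ⊓ homogeneousSubmodule (Option (Fin s)) K d))

/-- Evaluation of homogeneous polynomials at the points `(P, 1)`. -/
def evalProj (K : Type*) [Field K] {s n : ℕ} (v : Fin s → Fin n → ℕ) :
    MvPolynomial (Option (Fin s)) K →ₗ[K] (Xstar K v → K) :=
  LinearMap.pi fun p => (aeval (fun j : Option (Fin s) => j.elim 1 (p : Fin s → K))).toLinearMap

lemma evalProj_apply {K : Type*} [Field K] {s n : ℕ} (v : Fin s → Fin n → ℕ)
    (F : MvPolynomial (Option (Fin s)) K) (p : Xstar K v) :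
    evalProj K v F p = eval (fun j : Option (Fin s) => j.elim 1 (p : Fin s → K)) F := by
  simp [evalProj, aeval_eq_eval]

lemma evalAff_apply {K : Type*} [Field K] {s n : ℕ} (v : Fin s → Fin n → ℕ)
    (F : MvPolynomial (Fin s) K) (p : Xstar K v) :
    evalAff K v F p = eval (p : Fin s → K) F := by
  simp [evalAff, aeval_eq_eval]

lemma mem_IY_iff {K : Type*} [Field K] {s n : ℕ} (v : Fin s → Fin n → ℕ) (d : ℕ)
    (F : MvPolynomial (Option (Fin s)) K) (hF : F.IsHomogeneous d) :
    F ∈ IY K v ↔ evalProj K v F = 0 := by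
  constructor
  · intro h
    funext p
    rw [evalProj_apply]
    have : IY K v ≤ RingHom.ker (eval (fun j : Option (Fin s) => j.elim 1 (p : Fin s → K))) := by
      rw [IY, Ideal.span_le]
      rintro G ⟨-, hG⟩
      exact hG p p.2
    exact this h
  · intro h
    refine Ideal.subset_span ⟨⟨d, hF⟩, fun p hp => ?_⟩
    rw [← evalProj_apply v F ⟨p, hp⟩, h]
    rfl

lemma map_evalProj {K : Type*} [Field K] {s n : ℕ} (v : Fin s → Fin n → ℕ) (d : ℕ) :
    Submodule.map (evalProj K v) (homogeneousSubmodule (Option (Fin s)) K d) = CAff K v d := by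
  apply le_antisymm
  · rintro _ ⟨F, hF, rfl⟩
    have hF' : F.IsHomogeneous d := hF
    rw [F.as_sum, map_sum]
    refine Submodule.sum_mem _ fun m hm => ?_
    refine ⟨monomial m.some (coeff m F), ?_, ?_⟩
    · rw [SetLike.mem_coe, mem_restrictTotalDegree]
      refine (totalDegree_monomial_le _ _).trans ?_
      have := hF'.degree_eq_sum_deg_support hm
      rw [Finsupp.sum_fintype _ _ (by simp)]
      rw [this, ← Finsupp.degree_apply, Finsupp.degree_eq_sum, Fintype.sum_option]
      simp
    · funext p
      rw [evalProj_apply, evalAff_apply, eval_monomial, eval_monomial,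
        Finsupp.prod_fintype _ _ (by simp), Finsupp.prod_fintype _ _ (by simp),
        Fintype.prod_option]
      simp
  · rintro _ ⟨f, hf, rfl⟩
    rw [SetLike.mem_coe, mem_restrictTotalDegree] at hf
    rw [← f.sum_homogeneousComponent, map_sum]
    refine Submodule.sum_mem _ fun i hi => ?_
    have hi' : i ≤ d := by
      have := Finset.mem_range.1 hi
      omega
    refine ⟨rename some (homogeneousComponent i f) * X none ^ (d - i), ?_, ?_⟩
    · have h := (homogeneousComponent_isHomogeneous i f).rename_isHomogeneous
        (f := (some : Fin s → Option (Fin s)))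
      have h2 := h.mul (isHomogeneous_X_pow (R := K) (none : Option (Fin s)) (d - i))
      rw [Nat.add_sub_cancel' hi'] at h2
      exact h2
    · funext p
      rw [evalProj_apply, evalAff_apply]
      simp [eval_rename, Function.comp_def]

/-- **Theorem.** For every `d ≥ 1`, the dimension of the parameterized affine code
`C_{X*}(d)` equals the Hilbert function `H_Y(d)` of `S[u]/I(Y)` in degree `d`. -/
theorem dim_CAff_eq_hilbertFunction
    {K : Type*} [Field K] [Fintype K] {s n : ℕ}
    (v : Fin s → Fin n → ℕ) (d : ℕ) (hd : 1 ≤ d) :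
    Module.finrank K (CAff K v d) = HY K v d := by
  have hker : LinearMap.ker ((evalProj K v).domRestrict (homogeneousSubmodule (Option (Fin s)) K d))
      = Submodule.comap (homogeneousSubmodule (Option (Fin s)) K d).subtype
        (Submodule.restrictScalars K (IY K v) ⊓ homogeneousSubmodule (Option (Fin s)) K d) := by
    ext F
    have := mem_IY_iff v d F.1 F.2
    simp [this]
  rw [HY, ← hker, LinearEquiv.finrank_eq (LinearMap.quotKerEquivRange _),
    LinearMap.range_domRestrict, map_evalProj]

end
end

section
/- Let K = 𝔽_q with q ≥ 3 and let T = (K∖{0})^s be the affine torus in K^s. For d ≥ 1, the minimum distance of the parameterized affine code C_T(d) is: δ_T(d) = (q−1)^{s−k−1}(q−1−ℓ) if d ≤ (q−2)s − 1, where k ≥ 0 and 1 ≤ ℓ ≤ q−2 are the unique integers with d = k(q−2) + ℓ; and δ_T(d) = 1 if d ≥ (q−2)s. -/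
open MvPolynomial

noncomputable section

/-- The affine torus `T = (K \ {0})^s ⊆ K^s`. -/
def affineTorus (K : Type*) [Field K] (s : ℕ) : Set (Fin s → K) :=
  {p | ∀ i, p i ≠ 0}

/-- The evaluation map `S = K[t_1,…,t_s] → K^T`, `f ↦ (f(P))_{P ∈ T}`. -/
def evalT (K : Type*) [Field K] (s : ℕ) :
    MvPolynomial (Fin s) K →ₗ[K] (affineTorus K s → K) :=
  LinearMap.pi fun p => (aeval (p : Fin s → K)).toLinearMap

/-- The parameterized affine code `C_T(d)` on the affine torus: the image under
evaluation of the space `S_{≤ d}` of polynomials of total degree at most `d`. -/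
def CT (K : Type*) [Field K] (s : ℕ) (d : ℕ) : Submodule K (affineTorus K s → K) :=
  Submodule.map (evalT K s) (restrictTotalDegree (Fin s) K d)

/-- The recursive form of the minimum distance, with `a = q - 2`. -/
def NN (a : ℕ) : ℕ → ℕ → ℕ
  | 0, _ => 1
  | s + 1, d => if a ≤ d then NN a s (d - a) else (a + 1) ^ s * (a + 1 - d)

lemma NN_pos (a : ℕ) : ∀ s d, 0 < NN a s d
  | 0, _ => by simp [NN]
  | s + 1, d => by
    rw [NN]
    split_ifs with h
    · exact NN_pos a s _
    · have : 0 < a + 1 - d := by omega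
      positivity

lemma NN_rec (a : ℕ) : ∀ s d b, b ≤ a → b ≤ d →
    NN a (s + 1) d ≤ (a + 1 - b) * NN a s (d - b)
  | 0, d, b, hb, hd => by
    simp only [NN]
    split_ifs <;> simp <;> omega
  | s + 1, d, b, hb, hd => by
    rw [NN]
    by_cases h1 : a ≤ d - b
    · rw [if_pos (by omega)]
      have := NN_rec a s (d - a) b hb (by omega)
      have e : NN a (s + 1) (d - b) = NN a s (d - a - b) := by
        rw [NN, if_pos h1]; congr 1; omega
      rw [e]; exact this
    · have e : NN a (s + 1) (d - b) = (a + 1) ^ s * (a + 1 - (d - b)) := by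
        rw [NN, if_neg h1]
      rw [e]
      by_cases h2 : a ≤ d
      · rw [if_pos h2, NN, if_neg (by omega)]
        obtain ⟨x, hx⟩ := Nat.exists_eq_add_of_le hb
        obtain ⟨y, hy⟩ := Nat.exists_eq_add_of_le (show d - b ≤ a by omega)
        rw [show a + 1 - (d - a) = x + y + 1 by omega, show a + 1 - b = x + 1 by omega,
          show a + 1 - (d - b) = y + 1 by omega]
        have : x + y + 1 ≤ (x + 1) * (y + 1) := by nlinarith [Nat.zero_le (x * y)]
        calc (a + 1) ^ s * (x + y + 1) ≤ (a + 1) ^ s * ((x + 1) * (y + 1)) := by gcongr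
          _ = _ := by ring
      · rw [if_neg h2]
        obtain ⟨y, hy⟩ := Nat.exists_eq_add_of_le hd
        obtain ⟨z, hz⟩ := Nat.exists_eq_add_of_le (show d ≤ a by omega)
        rw [show a + 1 - d = z + 1 by omega, show a + 1 - b = y + z + 1 by omega,
          show a + 1 - (d - b) = b + z + 1 by omega, pow_succ]
        have : (a + 1) * (z + 1) ≤ (y + z + 1) * (b + z + 1) := by
          rw [hz, hy]; nlinarith [Nat.zero_le (y * b)]
        calc (a + 1) ^ s * (a + 1) * (z + 1) = (a + 1) ^ s * ((a + 1) * (z + 1)) := by ring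
          _ ≤ (a + 1) ^ s * ((y + z + 1) * (b + z + 1)) := by gcongr
          _ = _ := by ring

lemma NN_one (a : ℕ) : ∀ s d, a * s ≤ d → NN a s d = 1
  | 0, _, _ => by simp [NN]
  | s + 1, d, h => by
    rw [mul_add, mul_one] at h
    rw [NN, if_pos (by omega)]
    exact NN_one a s _ (by omega)

lemma NN_formula (a : ℕ) : ∀ s k l, 1 ≤ l → l ≤ a → k * a + l < a * s →
    NN a s (k * a + l) = (a + 1) ^ (s - k - 1) * (a + 1 - l)
  | 0, k, l, _, _, h => by simp at h
  | s + 1, 0, l, h1, h2, h => by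
    simp only [zero_mul, zero_add] at *
    rw [NN]
    split_ifs with h3
    · have : l = a := by omega
      subst this
      obtain _ | s := s
      · simp at h
      · have h4 : 0 < l := h1
        rw [NN, if_neg (by omega)]
        simp [pow_succ]
    · simp
  | s + 1, k + 1, l, h1, h2, h => by
    have e : (k + 1) * a + l = a + (k * a + l) := by ring
    rw [e] at h ⊢
    rw [mul_add, mul_one] at h
    rw [NN, if_pos (by omega), Nat.add_sub_cancel_left, NN_formula a s k l h1 h2 (by omega)]
    congr 2; omega

section
variable {K : Type*} [Field K]

lemma div_monomial {s : ℕ} (c : K) (m : Fin (s + 1) →₀ ℕ) (r : K) (d : ℕ)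
    (hm : (m.sum fun _ e => e) ≤ d) :
    ∃ h : MvPolynomial (Fin (s + 1)) K, (d = 0 → h = 0) ∧ h.totalDegree ≤ d - 1 ∧
      ∀ p : Fin (s + 1) → K, eval p (monomial m r) =
        eval (Fin.cons c (Fin.tail p)) (monomial m r) + (p 0 - c) * eval p h := by
  have hm' : m 0 + ∑ i : Fin s, m i.succ ≤ d := by
    rw [Finsupp.sum_fintype _ _ (by simp), Fin.sum_univ_succ] at hm
    exact hm
  refine ⟨C r * ((∑ i ∈ Finset.range (m 0), X 0 ^ i * C (c ^ (m 0 - 1 - i))) *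
    ∏ i : Fin s, X i.succ ^ m i.succ), ?_, ?_, ?_⟩
  · intro hd
    have : m 0 = 0 := by omega
    simp [this]
  · by_cases h0 : m 0 = 0
    · simp [h0]
    refine (totalDegree_mul _ _).trans ?_
    rw [totalDegree_C, zero_add]
    refine (totalDegree_mul _ _).trans ?_
    have h1 : (∑ i ∈ Finset.range (m 0),
        (X 0 ^ i * C (c ^ (m 0 - 1 - i)) : MvPolynomial (Fin (s + 1)) K)).totalDegree
        ≤ m 0 - 1 := by
      refine totalDegree_finsetSum_le fun i hi => ?_
      refine (totalDegree_mul _ _).trans ?_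
      rw [totalDegree_C, totalDegree_X_pow]
      have := Finset.mem_range.1 hi
      omega
    have h2 : (∏ i : Fin s, (X i.succ : MvPolynomial (Fin (s + 1)) K) ^ m i.succ).totalDegree
        ≤ ∑ i : Fin s, m i.succ := by
      refine (totalDegree_finsetProd _ _).trans ?_
      simp [totalDegree_X_pow]
    omega
  · intro p
    simp only [eval_monomial, map_mul, map_sum, map_prod, map_pow, eval_X, eval_C]
    rw [Finsupp.prod_fintype _ _ (by simp), Finsupp.prod_fintype _ _ (by simp),
      Fin.prod_univ_succ, Fin.prod_univ_succ]
    simp only [Fin.cons_zero, Fin.cons_succ, Fin.tail]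
    have := geom_sum₂_mul (p 0) c (m 0)
    linear_combination (- r * ∏ i : Fin s, p i.succ ^ m i.succ) * this

lemma div_poly {s : ℕ} (c : K) (f : MvPolynomial (Fin (s + 1)) K) (d : ℕ)
    (hf : f.totalDegree ≤ d) :
    ∃ h : MvPolynomial (Fin (s + 1)) K, (d = 0 → h = 0) ∧ h.totalDegree ≤ d - 1 ∧
      ∀ p : Fin (s + 1) → K, eval p f =
        eval (Fin.cons c (Fin.tail p)) f + (p 0 - c) * eval p h := by
  have H : ∀ m : Fin (s + 1) →₀ ℕ, ∃ h : MvPolynomial (Fin (s + 1)) K, m ∈ f.support →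
      (d = 0 → h = 0) ∧ h.totalDegree ≤ d - 1 ∧
      ∀ p : Fin (s + 1) → K, eval p (monomial m (f.coeff m)) =
        eval (Fin.cons c (Fin.tail p)) (monomial m (f.coeff m)) + (p 0 - c) * eval p h := by
    intro m
    by_cases hm : m ∈ f.support
    · obtain ⟨h, hh⟩ := div_monomial c m (f.coeff m) d ((le_totalDegree hm).trans hf)
      exact ⟨h, fun _ => hh⟩
    · exact ⟨0, fun h => absurd h hm⟩
  choose h hh using H
  refine ⟨∑ m ∈ f.support, h m, ?_, ?_, ?_⟩
  · intro hd
    exact Finset.sum_eq_zero fun m hm => (hh m hm).1 hd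
  · exact totalDegree_finsetSum_le fun m hm => (hh m hm).2.1
  · intro p
    conv_lhs => rw [f.as_sum]
    have e : eval (Fin.cons c (Fin.tail p)) f =
      eval (Fin.cons c (Fin.tail p)) (∑ v ∈ f.support, monomial v (f.coeff v)) := by
      rw [← f.as_sum]
    rw [e, map_sum, map_sum, map_sum, Finset.mul_sum, ← Finset.sum_add_distrib]
    exact Finset.sum_congr rfl fun m hm => (hh m hm).2.2 p

lemma spec_poly {s : ℕ} (c : K) (f : MvPolynomial (Fin (s + 1)) K) :
    ∃ g : MvPolynomial (Fin s) K, g.totalDegree ≤ f.totalDegree ∧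
      ∀ p : Fin s → K, eval p g = eval (Fin.cons c p) f := by
  refine ⟨Polynomial.eval (C c) (finSuccEquiv K s f), ?_, ?_⟩
  · rw [Polynomial.eval_eq_sum]
    refine totalDegree_finsetSum_le fun i hi => ?_
    refine (totalDegree_mul _ _).trans ?_
    rw [← C_pow, totalDegree_C, add_zero]
    have := totalDegree_coeff_finSuccEquiv_add_le f i (Polynomial.mem_support_iff.1 hi)
    omega
  · intro p
    rw [eval_polynomial_eval_finSuccEquiv, eval_C]
    rfl

variable [Fintype K] [DecidableEq K]
open Classical in
/-- The number of points of the torus where `f` is nonzero. -/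
def cnt {s : ℕ} (f : MvPolynomial (Fin s) K) : ℕ :=
  Fintype.card {p : Fin s → Kˣ // eval (fun i => (p i : K)) f ≠ 0}

lemma cons_coe {s : ℕ} (c : Kˣ) (p : Fin s → Kˣ) :
    (fun i => ((Fin.cons c p : Fin (s + 1) → Kˣ) i : K)) =
      Fin.cons (c : K) (fun i => (p i : K)) := by
  funext i
  refine Fin.cases ?_ (fun i => ?_) i <;> simp

lemma split_roots {s : ℕ} (f : MvPolynomial (Fin (s + 1)) K) (d : ℕ) (hf : f.totalDegree ≤ d)
    (hne : ∃ p : Fin (s + 1) → Kˣ, eval (fun i => (p i : K)) f ≠ 0) (B : Finset Kˣ)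
    (hB : ∀ c ∈ B, ∀ p : Fin s → Kˣ, eval (Fin.cons (c : K) (fun i => (p i : K))) f = 0) :
    ∃ g : MvPolynomial (Fin (s + 1)) K, B.card + g.totalDegree ≤ d ∧
      ∀ (c : Kˣ) (p : Fin s → Kˣ), eval (Fin.cons (c : K) (fun i => (p i : K))) f =
        (∏ b ∈ B, ((c : K) - b)) * eval (Fin.cons (c : K) (fun i => (p i : K))) g := by
  classical
  induction B using Finset.induction_on with
  | empty => exact ⟨f, by simpa using hf, by simp⟩
  | insert b B hb ih =>
    obtain ⟨g, hg, hfg⟩ := ih fun c hc => hB c (Finset.mem_insert_of_mem hc)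
    have hz : ∀ p : Fin s → Kˣ, eval (Fin.cons (b : K) (fun i => (p i : K))) g = 0 := by
      intro p
      have h1 := hB b (Finset.mem_insert_self _ _) p
      rw [hfg] at h1
      refine (mul_eq_zero.1 h1).resolve_left ?_
      change _ ≠ _
      rw [Finset.prod_ne_zero_iff]
      intro x hx h2
      rw [sub_eq_zero, Units.val_inj] at h2
      exact hb (h2 ▸ hx)
    obtain ⟨h, h0, hd, hh⟩ := div_poly (b : K) g g.totalDegree le_rfl
    have key : ∀ (c : Kˣ) (p : Fin s → Kˣ), eval (Fin.cons (c : K) (fun i => (p i : K))) f =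
        (∏ b ∈ insert b B, ((c : K) - b)) *
          eval (Fin.cons (c : K) (fun i => (p i : K))) h := by
      intro c p
      rw [hfg, hh, Fin.tail_cons, hz, Finset.prod_insert hb, Fin.cons_zero]
      ring
    refine ⟨h, ?_, key⟩
    rw [Finset.card_insert_of_notMem hb]
    by_cases hg0 : g.totalDegree = 0
    · exfalso
      obtain ⟨p, hp⟩ := hne
      apply hp
      rw [← Fin.cons_self_tail p, cons_coe, key, h0 hg0]
      simp
    · omega

lemma cnt_succ {s : ℕ} (f : MvPolynomial (Fin (s + 1)) K) :
    ∀ g : Kˣ → MvPolynomial (Fin s) K,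
    (∀ (c : Kˣ) (p : Fin s → Kˣ), eval (Fin.cons (c : K) (fun i => (p i : K))) f ≠ 0 ↔
      eval (fun i => (p i : K)) (g c) ≠ 0) → 
    cnt f = ∑ c : Kˣ, cnt (g c) := by
  classical
  intro g hg
  unfold cnt
  rw [← Fintype.card_sigma]
  refine Fintype.card_congr (Equiv.trans (Equiv.subtypeEquiv
    (q := fun x : Kˣ × (Fin s → Kˣ) => eval (fun i => (x.2 i : K)) (g x.1) ≠ 0)
    (Fin.consEquiv (fun _ => Kˣ)).symm ?_)
    (Equiv.subtypeProdEquivSigmaSubtype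
      fun c (p : Fin s → Kˣ) => eval (fun i => (p i : K)) (g c) ≠ 0))
  intro p
  rw [← hg, ← cons_coe]
  simp [Fin.consEquiv]

lemma lower (a : ℕ) (ha : Fintype.card Kˣ = a + 1) : ∀ (s d : ℕ) (f : MvPolynomial (Fin s) K),
    f.totalDegree ≤ d → (∃ p : Fin s → Kˣ, eval (fun i => (p i : K)) f ≠ 0) →
    NN a s d ≤ cnt f := by
  classical
  intro s
  induction s with
  | zero =>
    intro d f hf ⟨p, hp⟩
    simp only [NN, cnt]
    exact Fintype.card_pos_iff.2 ⟨⟨p, hp⟩⟩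
  | succ s ih =>
    intro d f hf hne
    let B : Finset Kˣ := Finset.univ.filter fun c =>
      ∀ p : Fin s → Kˣ, eval (Fin.cons (c : K) (fun i => (p i : K))) f = 0
    obtain ⟨g, hg, hfg⟩ := split_roots f d hf hne B (fun c hc => (Finset.mem_filter.1 hc).2)
    have hBlt : B.card < a + 1 := by
      rw [← ha]
      obtain ⟨p, hp⟩ := hne
      apply Finset.card_lt_univ_of_notMem (x := p 0)
      intro h
      apply hp
      have := (Finset.mem_filter.1 h).2 (Fin.tail p)
      rw [← cons_coe, Fin.cons_self_tail] at this
      exact this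
    choose F hF1 hF2 using fun c : Kˣ => spec_poly (c : K) f
    choose G hG1 hG2 using fun c : Kˣ => spec_poly (c : K) g
    rw [cnt_succ f F (fun c p => by rw [hF2])]
    have hc : ∀ c ∈ Bᶜ, NN a s (d - B.card) ≤ cnt (F c) := by
      intro c hc
      have hcB : c ∉ B := Finset.mem_compl.1 hc
      have hprod : (∏ b ∈ B, ((c : K) - b)) ≠ 0 := by
        rw [Finset.prod_ne_zero_iff]
        intro x hx h2
        rw [sub_eq_zero, Units.val_inj] at h2
        exact hcB (h2 ▸ hx)
      have hiff : ∀ p : Fin s → Kˣ, eval (fun i => (p i : K)) (F c) ≠ 0 ↔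
          eval (fun i => (p i : K)) (G c) ≠ 0 := by
        intro p
        rw [hF2, hG2, hfg]
        simp [hprod]
      have e : cnt (F c) = cnt (G c) := by
        unfold cnt
        exact Fintype.card_congr (Equiv.subtypeEquivRight hiff)
      rw [e]
      refine ih _ _ ((hG1 c).trans (by omega)) ?_
      have : ∃ p : Fin s → Kˣ, eval (Fin.cons (c : K) (fun i => (p i : K))) f ≠ 0 := by
        by_contra! h
        exact hcB (Finset.mem_filter.2 ⟨Finset.mem_univ _, h⟩)
      obtain ⟨p, hp⟩ := this
      exact ⟨p, (hiff p).1 (by rwa [hF2])⟩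
    calc NN a (s + 1) d ≤ (a + 1 - B.card) * NN a s (d - B.card) :=
          NN_rec a s d _ (by omega) (by omega)
      _ = ∑ c ∈ Bᶜ, NN a s (d - B.card) := by
          rw [Finset.sum_const, Finset.card_compl, ha, smul_eq_mul]
      _ ≤ ∑ c ∈ Bᶜ, cnt (F c) := Finset.sum_le_sum hc
      _ ≤ ∑ c : Kˣ, cnt (F c) := Finset.sum_le_sum_of_subset (Finset.subset_univ _)

lemma cnt_zero {s : ℕ} : cnt (0 : MvPolynomial (Fin s) K) = 0 := by
  classical
  unfold cnt
  simp

lemma cnt_one {s : ℕ} : cnt (1 : MvPolynomial (Fin s) K) = Fintype.card Kˣ ^ s := by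
  classical
  unfold cnt
  rw [Fintype.card_congr (Equiv.subtypeUnivEquiv (by simp))]
  simp

lemma upper_step (a : ℕ) (ha : Fintype.card Kˣ = a + 1) {s : ℕ} (b : ℕ) (hb : b ≤ a)
    (f : MvPolynomial (Fin s) K) :
    ∃ g : MvPolynomial (Fin (s + 1)) K, g.totalDegree ≤ b + f.totalDegree ∧
      cnt g = (a + 1 - b) * cnt f := by
  classical
  obtain ⟨B, -, hB⟩ := Finset.exists_subset_card_eq
    (show b ≤ (Finset.univ : Finset Kˣ).card by rw [Finset.card_univ, ha]; omega)
  refine ⟨(∏ c ∈ B, (X 0 - C (c : K))) * rename Fin.succ f, ?_, ?_⟩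
  · refine (totalDegree_mul _ _).trans (add_le_add ?_ (totalDegree_rename_le _ _))
    refine (totalDegree_finsetProd _ _).trans ?_
    rw [← hB, Finset.card_eq_sum_ones]
    refine Finset.sum_le_sum fun c _ => ?_
    refine (totalDegree_sub _ _).trans ?_
    simp [totalDegree_X]
  · rw [cnt_succ _ (fun c => if c ∈ B then 0 else f)]
    · have : ∀ c : Kˣ, cnt (if c ∈ B then 0 else f) = if c ∈ Bᶜ then cnt f else 0 := by
        intro c
        by_cases h : c ∈ B <;> simp [h, cnt_zero]
      simp only [this]
      rw [Finset.sum_ite_mem, Finset.univ_inter, Finset.sum_const, Finset.card_compl, ha, hB,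
        smul_eq_mul]
    · intro c p
      have e : (Fin.cons (c : K) (fun i => (p i : K)) : Fin (s + 1) → K) ∘ Fin.succ =
          fun i => (p i : K) := by
        funext i; simp
      rw [map_mul, eval_rename, e, map_prod]
      simp only [map_sub, eval_X, eval_C, Fin.cons_zero]
      by_cases h : c ∈ B
      · rw [if_pos h, Finset.prod_eq_zero h (sub_self _)]
        simp
      · have hprod : (∏ b ∈ B, ((c : K) - b)) ≠ 0 := by
          rw [Finset.prod_ne_zero_iff]
          intro x hx h2
          rw [sub_eq_zero, Units.val_inj] at h2
          exact h (h2 ▸ hx)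
        simp [h, hprod]

lemma upper (a : ℕ) (ha : Fintype.card Kˣ = a + 1) : ∀ (s d : ℕ),
    ∃ f : MvPolynomial (Fin s) K, f.totalDegree ≤ d ∧ cnt f = NN a s d
  | 0, d => ⟨1, by simp, by simp [cnt_one, NN]⟩
  | s + 1, d => by
    by_cases h : a ≤ d
    · obtain ⟨f, hf, hc⟩ := upper a ha s (d - a)
      obtain ⟨g, hg, hgc⟩ := upper_step a ha a le_rfl f
      refine ⟨g, by omega, ?_⟩
      rw [hgc, hc, NN, if_pos h]
      simp
    · obtain ⟨g, hg, hgc⟩ := upper_step a ha d (by omega) (1 : MvPolynomial (Fin s) K)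
      refine ⟨g, by simpa using hg, ?_⟩
      rw [hgc, cnt_one, NN, if_neg h, ha, mul_comm]

/-- The torus as a power of the unit group. -/
def torusEquiv (s : ℕ) : (Fin s → Kˣ) ≃ affineTorus K s where
  toFun p := ⟨fun i => p i, fun i => (p i).ne_zero⟩
  invFun p := fun i => Units.mk0 (p.1 i) (p.2 i)
  left_inv p := by funext i; simp
  right_inv p := by ext i; simp

lemma evalT_apply {s : ℕ} (f : MvPolynomial (Fin s) K) (x : affineTorus K s) :
    evalT K s f x = eval (x : Fin s → K) f := by
  change aeval (x : Fin s → K) f = _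
  rw [aeval_eq_eval]

lemma wt_evalT {s : ℕ} (f : MvPolynomial (Fin s) K) : wt (evalT K s f) = cnt f := by
  classical
  unfold wt cnt
  rw [← Nat.card_coe_set_eq, ← Nat.card_eq_fintype_card]
  refine (Nat.card_congr (Equiv.subtypeEquiv (torusEquiv s) ?_)).symm
  intro p
  change _ ↔ evalT K s f (torusEquiv s p) ≠ 0
  rw [evalT_apply]
  rfl

lemma minDist_eq (a : ℕ) (ha : Fintype.card Kˣ = a + 1) (s d : ℕ) :
    minDist (CT K s d) = NN a s d := by
  classical
  apply le_antisymm
  · obtain ⟨f, hf, hc⟩ := upper (K := K) a ha s d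
    apply Nat.sInf_le
    refine ⟨evalT K s f, Submodule.mem_map_of_mem ?_, ?_, ?_⟩
    · rwa [mem_restrictTotalDegree]
    · intro h
      have h1 := wt_evalT f
      rw [h, hc] at h1
      have := NN_pos a s d
      simp [wt] at h1
      omega
    · rw [wt_evalT, hc]
  · apply le_csInf
    · obtain ⟨f, hf, hc⟩ := upper (K := K) a ha s d
      refine ⟨_, evalT K s f, Submodule.mem_map_of_mem ?_, ?_, rfl⟩
      · rwa [mem_restrictTotalDegree]
      · intro h
        have h1 := wt_evalT f
        rw [h, hc] at h1
        have := NN_pos a s d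
        simp [wt] at h1
        omega
    · rintro m ⟨w, hw, hw0, rfl⟩
      obtain ⟨f, hf, rfl⟩ := Submodule.mem_map.1 hw
      rw [mem_restrictTotalDegree] at hf
      rw [wt_evalT]
      refine lower a ha s d f hf ?_
      by_contra! h
      apply hw0
      funext x
      have := h ((torusEquiv s).symm x)
      rw [evalT_apply]
      exact this

end

/-- **Corollary.** Let `K = 𝔽_q` with `q ≥ 3` and let `T = (K \ {0})^s` be the affine
torus.  For `d ≥ 1`, the minimum distance of `C_T(d)` is
`(q−1)^{s−k−1}(q−1−ℓ)` if `d ≤ (q−2)s − 1`, where `k ≥ 0` and `1 ≤ ℓ ≤ q−2` are the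
unique integers with `d = k(q−2) + ℓ`, and it is `1` if `d ≥ (q−2)s`. -/
theorem minDist_CT
    {K : Type*} [Field K] [Fintype K] {q s : ℕ} (hq : Fintype.card K = q)
    (h3 : 3 ≤ q) (hs : 0 < s) (d : ℕ) (hd : 1 ≤ d) :
    (∀ k ℓ : ℕ, d = k * (q - 2) + ℓ → 1 ≤ ℓ → ℓ ≤ q - 2 → d ≤ (q - 2) * s - 1 →
        minDist (CT K s d) = (q - 1) ^ (s - k - 1) * (q - 1 - ℓ)) ∧
      ((q - 2) * s ≤ d → minDist (CT K s d) = 1) := by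
  classical
  have ha : Fintype.card Kˣ = (q - 2) + 1 := by
    rw [Fintype.card_units, hq]; omega
  rw [minDist_eq (q - 2) ha]
  refine ⟨fun k l hdk h1 h2 hle => ?_, fun h => NN_one _ _ _ h⟩
  subst hdk
  rw [NN_formula (q - 2) s k l h1 h2 (by omega), show q - 2 + 1 = q - 1 by omega]

end
end

section
/- Let K = 𝔽_q and let T = (K∖{0})^s be the affine torus in K^s. For every d ≥ 1, the length of C_T(d) is (q−1)^s and its dimension is dim_K C_T(d) = Σ_{j=0}^{⌊d/(q−1)⌋} (−1)^j · C(s, j) · C(s + d − j(q−1), s), where C(a, b) denotes the binomial coefficient. -/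
open MvPolynomial

noncomputable section

/-- The reduced monomial functions on the torus. -/
def redMon (K : Type*) [Field K] (s n : ℕ) (a : Fin s → Fin n) : affineTorus K s → K :=
  fun p => ∏ i, (p : Fin s → K) i ^ (a i : ℕ)

lemma redMon_linInd (K : Type*) [Field K] [Fintype K] (s n : ℕ) (hn : Fintype.card K - 1 = n) :
    LinearIndependent K (redMon K s n) := by
  classical
  obtain ⟨g, hg⟩ := IsCyclic.exists_generator (α := Kˣ)
  have hord : orderOf g = n := by
    rw [orderOf_eq_card_of_forall_mem_zpowers hg, Nat.card_eq_fintype_card, Fintype.card_units, hn]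
  let χ : (Fin s → Fin n) → ((Fin s → Kˣ) →* K) := fun a =>
    { toFun := fun u => ∏ i, (u i : K) ^ (a i : ℕ)
      map_one' := by simp
      map_mul' := fun u v => by simp [mul_pow, Finset.prod_mul_distrib] }
  have hχ : Function.Injective χ := by
    intro a b hab
    funext i
    have h := DFunLike.congr_fun hab (Pi.mulSingle i g)
    have key : ∀ c : Fin s → Fin n, χ c (Pi.mulSingle i g) = (g : K) ^ (c i : ℕ) := by
      intro c
      change ∏ j, ((Pi.mulSingle i g : Fin s → Kˣ) j : K) ^ (c j : ℕ) = _
      rw [Finset.prod_eq_single i]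
      · simp
      · intro j _ hj
        simp [Pi.mulSingle_eq_of_ne hj]
      · simp
    rw [key, key] at h
    have h2 : g ^ (a i : ℕ) = g ^ (b i : ℕ) := by
      ext; simpa using h
    apply Fin.ext
    exact pow_injOn_Iio_orderOf (by simp [hord]) (by simp [hord]) h2
  have hli := (linearIndependent_monoidHom (Fin s → Kˣ) K).comp χ hχ
  let e : (Fin s → Kˣ) → affineTorus K s := fun u => ⟨fun i => (u i : K), fun i => (u i).ne_zero⟩
  exact LinearIndependent.of_comp (LinearMap.funLeft K K e) hli

lemma evalT_monomial (K : Type*) [Field K] (s : ℕ) (m : Fin s →₀ ℕ) (c : K)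
    (p : affineTorus K s) :
    evalT K s (monomial m c) p = c * ∏ i, (p : Fin s → K) i ^ m i := by
  simp [evalT, aeval_monomial, Finsupp.prod_fintype]

lemma CT_eq_span (K : Type*) [Field K] [Fintype K] (s n d : ℕ) (hn : Fintype.card K - 1 = n) :
    CT K s d = Submodule.span K (Set.range
      fun a : {a : Fin s → Fin n // ∑ i, (a i : ℕ) ≤ d} => redMon K s n a) := by
  classical
  have hn0 : 0 < n := by
    have := Fintype.one_lt_card (α := K)
    omega
  apply le_antisymm
  · rw [CT, Submodule.map_le_iff_le_comap]
    intro f hf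
    rw [mem_restrictTotalDegree] at hf
    rw [Submodule.mem_comap, f.as_sum, map_sum]
    refine Submodule.sum_mem _ fun m hm => ?_
    have hdeg : ∑ i, m i ≤ d := by
      have := le_totalDegree hm
      rw [Finsupp.sum_fintype _ _ (by simp)] at this
      omega
    let a : Fin s → Fin n := fun i => ⟨m i % n, Nat.mod_lt _ hn0⟩
    have ha : ∑ i, (a i : ℕ) ≤ d :=
      (Finset.sum_le_sum fun i _ => Nat.mod_le (m i) n).trans hdeg
    have : evalT K s (monomial m (coeff m f)) = coeff m f • redMon K s n a := by
      funext p
      rw [evalT_monomial, Pi.smul_apply, smul_eq_mul, redMon]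
      congr 1
      refine Finset.prod_congr rfl fun i _ => ?_
      have h1 : (p : Fin s → K) i ^ n = 1 := by
        rw [← hn]; exact FiniteField.pow_card_sub_one_eq_one _ (p.2 i)
      exact pow_eq_pow_mod _ h1
    rw [this]
    exact Submodule.smul_mem _ _ (Submodule.subset_span ⟨⟨a, ha⟩, rfl⟩)
  · rw [Submodule.span_le]
    rintro _ ⟨⟨a, ha⟩, rfl⟩
    refine ⟨monomial (Finsupp.equivFunOnFinite.symm fun i => (a i : ℕ)) 1, ?_, ?_⟩
    · rw [SetLike.mem_coe, mem_restrictTotalDegree, totalDegree_monomial _ one_ne_zero,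
        Finsupp.sum_fintype _ _ (by simp)]
      simpa using ha
    · funext p
      rw [evalT_monomial]
      simp [redMon]

lemma count_eq (s n d : ℕ) (hn : 0 < n) :
    (Fintype.card {a : Fin s → Fin n // ∑ i, (a i : ℕ) ≤ d} : ℤ) =
      ∑ j ∈ Finset.range (d / n + 1),
        (-1 : ℤ) ^ j * (s.choose j : ℤ) * ((s + d - j * n).choose s : ℤ) := by
  classical
  have hinv : ∀ k, ((1 : PowerSeries ℤ) - PowerSeries.X) ^ (k + 1) *
      PowerSeries.mk (fun m => ((k + m).choose k : ℤ)) = 1 := by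
    intro k
    rw [mul_comm]
    exact PowerSeries.mk_add_choose_mul_one_sub_pow_eq_one ℤ k
  have hone := hinv 0
  have hs := hinv s
  set A := PowerSeries.mk (fun m => ((0 + m).choose 0 : ℤ)) with hA
  set B := PowerSeries.mk (fun m => ((s + m).choose s : ℤ)) with hB
  have hgeom : ((1 : PowerSeries ℤ) - PowerSeries.X) * (∑ k : Fin n, PowerSeries.X ^ (k : ℕ)) =
      1 - PowerSeries.X ^ n := by
    rw [Fin.sum_univ_eq_sum_range (fun k => (PowerSeries.X : PowerSeries ℤ) ^ k) n,
      mul_neg_geom_sum]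
  have hGF : (∑ k : Fin n, (PowerSeries.X : PowerSeries ℤ) ^ (k : ℕ)) ^ s * A =
      (1 - PowerSeries.X ^ n) ^ s * B := by
    rw [← hgeom]
    generalize (∑ k : Fin n, (PowerSeries.X : PowerSeries ℤ) ^ (k : ℕ)) = G at *
    rw [mul_pow]
    calc G ^ s * A = G ^ s * A * ((1 - PowerSeries.X) ^ (s + 1) * B) := by rw [hs, mul_one]
      _ = ((1 - PowerSeries.X) ^ s * G ^ s * B) * ((1 - PowerSeries.X) ^ (0 + 1) * A) := by ring
      _ = _ := by rw [hone, mul_one]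
  have hc := congrArg (PowerSeries.coeff d) hGF
  have hL : PowerSeries.coeff d ((∑ k : Fin n, (PowerSeries.X : PowerSeries ℤ) ^ (k : ℕ)) ^ s * A)
      = (Fintype.card {a : Fin s → Fin n // ∑ i, (a i : ℕ) ≤ d} : ℤ) := by
    rw [Fintype.sum_pow, Finset.sum_mul, map_sum, Fintype.card_subtype, Finset.card_filter]
    push_cast
    refine Finset.sum_congr rfl fun a _ => ?_
    rw [Finset.prod_pow_eq_pow_sum, PowerSeries.coeff_X_pow_mul']
    simp [hA]
  have hR : PowerSeries.coeff d ((1 - PowerSeries.X ^ n) ^ s * B) =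
      ∑ j ∈ Finset.range (s + 1), if j * n ≤ d then
        (-1 : ℤ) ^ j * (s.choose j : ℤ) * ((s + d - j * n).choose s : ℤ) else 0 := by
    rw [sub_eq_neg_add, add_pow, Finset.sum_mul, map_sum]
    refine Finset.sum_congr rfl fun j _ => ?_
    have : (-(PowerSeries.X : PowerSeries ℤ) ^ n) ^ j * 1 ^ (s - j) * (s.choose j : PowerSeries ℤ) * B
        = PowerSeries.X ^ (j * n) * (PowerSeries.C ((-1 : ℤ) ^ j * (s.choose j : ℤ)) * B) := by
      rw [neg_pow, ← pow_mul, mul_comm n j]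
      simp
      ring
    rw [this, PowerSeries.coeff_X_pow_mul']
    split_ifs with h
    · rw [PowerSeries.coeff_C_mul, hB, PowerSeries.coeff_mk, Nat.add_sub_assoc h]
    · rfl
  rw [← hL, hc, hR, ← Finset.sum_filter]
  have hset : (Finset.range (s + 1)).filter (fun j => j * n ≤ d) ⊆ Finset.range (d / n + 1) := by
    intro j hj
    rw [Finset.mem_filter] at hj
    rw [Finset.mem_range, Nat.lt_succ_iff, Nat.le_div_iff_mul_le hn]
    exact hj.2
  refine Finset.sum_subset hset fun j hj hj' => ?_
  rw [Finset.mem_range, Nat.lt_succ_iff, Nat.le_div_iff_mul_le hn] at hj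
  have : s < j := by
    by_contra hlt
    exact hj' (by rw [Finset.mem_filter, Finset.mem_range]; exact ⟨by omega, hj⟩)
  simp [Nat.choose_eq_zero_of_lt this]

lemma card_torus (K : Type*) [Field K] [Fintype K] (s : ℕ) :
    Set.ncard (affineTorus K s) = (Fintype.card K - 1) ^ s := by
  classical
  let e : (Fin s → Kˣ) ≃ affineTorus K s :=
    { toFun := fun u => ⟨fun i => (u i : K), fun i => (u i).ne_zero⟩
      invFun := fun p i => Units.mk0 (p.1 i) (p.2 i)
      left_inv := fun u => by ext; simp
      right_inv := fun p => by ext; simp }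
  rw [← Nat.card_coe_set_eq, ← Nat.card_congr e, Nat.card_eq_fintype_card]
  simp [Fintype.card_units]

/-- **Corollary.** Let `K = 𝔽_q` and let `T = (K \ {0})^s` be the affine torus.
For every `d ≥ 1`, the length of `C_T(d)` is `(q−1)^s` and its dimension is
`dim_K C_T(d) = Σ_{j=0}^{⌊d/(q−1)⌋} (−1)^j (s choose j) ((s + d − j(q−1)) choose s)`. -/
theorem length_and_dim_CT
    {K : Type*} [Field K] [Fintype K] {q s : ℕ} (hq : Fintype.card K = q)
    (hs : 0 < s) (d : ℕ) (hd : 1 ≤ d) :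
    Set.ncard (affineTorus K s) = (q - 1) ^ s ∧
      (Module.finrank K (CT K s d) : ℤ) =
        ∑ j ∈ Finset.range (d / (q - 1) + 1),
          (-1 : ℤ) ^ j * (s.choose j : ℤ) * (((s + d - j * (q - 1)).choose s : ℤ)) := by
  classical
  subst hq
  refine ⟨card_torus K s, ?_⟩
  have hli : LinearIndependent K
      (fun a : {a : Fin s → Fin (Fintype.card K - 1) // ∑ i, (a i : ℕ) ≤ d} =>
        redMon K s (Fintype.card K - 1) a) :=
    (redMon_linInd K s _ rfl).comp Subtype.val Subtype.val_injective
  rw [CT_eq_span K s _ d rfl, finrank_span_eq_card hli]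
  refine count_eq s _ d ?_
  have := Fintype.one_lt_card (α := K)
  omega

end
end
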